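/- Let p, q be coprime integers, both odd, and let x, y be real numbers with |x| ≤ 1, x² + y² ≥ 1 and y > 0. If y/((p + qx)² + (qy)²) > 1, then |p| = 1 and |q| = 1. -/

import Mathlib

theorem Int.four_le_sq_of_even_of_ne_zero {n : ℤ} (hn : Even n) (h0 : n ≠ 0) : 4 ≤ n ^ 2 := by
  obtain ⟨k, rfl⟩ := hn
  have hk : 0 < k ^ 2 := by
    have : k ≠ 0 := by rintro rfl; simp at h0
    positivity
  nlinarith

theorem Int.abs_eq_one_of_isCoprime_of_abs_eq {p q : ℤ} (hcop : IsCoprime p q)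
    (h : |p| = |q|) : |p| = 1 ∧ |q| = 1 := by
  have hp : |p| = 1 :=
    Int.isUnit_iff_abs_eq.mp (hcop.isUnit_of_dvd' dvd_rfl ((abs_dvd_abs p q).mp h.dvd))
  exact ⟨hp, h ▸ hp⟩

theorem stmt7 (p q : ℤ) (hcop : IsCoprime p q) (hpodd : Odd p) (hqodd : Odd q)
    (x y : ℝ) (hx : |x| ≤ 1) (hxy : x^2 + y^2 ≥ 1) (hy : 0 < y)
    (h : y / (((p : ℝ) + q * x)^2 + (q * y)^2) > 1) :
    |p| = 1 ∧ |q| = 1 := by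
  by_contra hne
  have habs : |p| ≠ |q| := fun h' => hne (Int.abs_eq_one_of_isCoprime_of_abs_eq hcop h')
  have hadd : (4 : ℝ) ≤ ((p : ℝ) + q) ^ 2 := by
    exact_mod_cast Int.four_le_sq_of_even_of_ne_zero (hpodd.add_odd hqodd)
      fun h0 => habs (abs_eq_abs.mpr (Or.inr (eq_neg_of_add_eq_zero_left h0)))
  have hsub : (4 : ℝ) ≤ ((p : ℝ) - q) ^ 2 := by
    exact_mod_cast Int.four_le_sq_of_even_of_ne_zero (hpodd.sub_odd hqodd)
      fun h0 => habs (abs_eq_abs.mpr (Or.inl (sub_eq_zero.mp h0)))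
  have hq : (1 : ℝ) ≤ (q : ℝ) ^ 2 := by
    have hq0 : q ≠ 0 := by rintro rfl; simp at hqodd
    have : 0 < q ^ 2 := by positivity
    exact_mod_cast this
  have hlt : ((p : ℝ) + q * x) ^ 2 + (q * y) ^ 2 < y := by
    have hden : 0 < ((p : ℝ) + q * x) ^ 2 + (q * y) ^ 2 := by
      have : 0 < (q : ℝ) ^ 2 * y ^ 2 := by positivity
      nlinarith [sq_nonneg ((p : ℝ) + q * x)]
    exact (one_lt_div hden).mp h
  have hy_lt : y < 1 := by
    have : y ^ 2 ≤ (q : ℝ) ^ 2 * y ^ 2 := le_mul_of_one_le_left (sq_nonneg y) hq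
    nlinarith [sq_nonneg ((p : ℝ) + q * x)]
  obtain ⟨hx₁, hx₂⟩ := abs_le.mp hx
  have hfour : 4 ≤ (p : ℝ) ^ 2 + 2 * p * q * x + q ^ 2 := by
    linarith [mul_le_mul_of_nonneg_left hadd (by linarith : 0 ≤ 1 + x),
      mul_le_mul_of_nonneg_left hsub (by linarith : 0 ≤ 1 - x)]
  have hnorm : (q : ℝ) ^ 2 ≤ q ^ 2 * (x ^ 2 + y ^ 2) :=
    le_mul_of_one_le_right (sq_nonneg _) hxy
  linarith
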